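/- arXiv:1706.06217 — 4 statements merged into one kernel-verified Lean document; each statement's English description precedes it below -/
import Mathlib

section
/- Let m > 0 and define the polar curve γ(ψ) = exp(−m(1 − cos ψ))·(cos ψ, sin ψ). Then det[γ'(ψ), γ''(ψ)] > 0 for all ψ ∈ ℝ if and only if m < 1. Consequently, in the model with penalty factor f(ρ̄, ψ) = exp(−β ρ̄²(1 − cos ψ)) (β > 0), the velocity profile has everywhere-positive curvature numerator exactly when ρ̄ < 1/√β, and in the model with f(ρ̄, ψ) = exp(−β ρ̄(1 − cos ψ)) exactly when ρ̄ < 1/β. -/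
/-- The curvature numerator `det [γ', γ'']` of the polar curve
`γ(ψ) = f(ψ)(cos ψ, sin ψ)`. -/
noncomputable def polarCurvNum (f : ℝ → ℝ) (ψ : ℝ) : ℝ :=
  deriv (fun t => f t * Real.cos t) ψ *
      deriv (deriv (fun t => f t * Real.sin t)) ψ -
    deriv (fun t => f t * Real.sin t) ψ *
      deriv (deriv (fun t => f t * Real.cos t)) ψ

/-- The curvature numerator of a twice differentiable polar curve, without trigonometric terms. -/
lemma polarCurvNum_eq {f f' f'' : ℝ → ℝ} (hf : ∀ t, HasDerivAt f (f' t) t)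
    (hf' : ∀ t, HasDerivAt f' (f'' t) t) (ψ : ℝ) :
    polarCurvNum f ψ = f ψ ^ 2 + 2 * f' ψ ^ 2 - f ψ * f'' ψ := by
  have hc : deriv (fun t => f t * Real.cos t) = fun t => f' t * Real.cos t + f t * -Real.sin t :=
    funext fun t => ((hf t).mul (Real.hasDerivAt_cos t)).deriv
  have hs : deriv (fun t => f t * Real.sin t) = fun t => f' t * Real.sin t + f t * Real.cos t :=
    funext fun t => ((hf t).mul (Real.hasDerivAt_sin t)).deriv
  have hcc : deriv (fun t => f' t * Real.cos t + f t * -Real.sin t) ψ = _ :=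
    (((hf' ψ).mul (Real.hasDerivAt_cos ψ)).add
      ((hf ψ).mul (Real.hasDerivAt_sin ψ).neg)).deriv
  have hss : deriv (fun t => f' t * Real.sin t + f t * Real.cos t) ψ = _ :=
    (((hf' ψ).mul (Real.hasDerivAt_sin ψ)).add
      ((hf ψ).mul (Real.hasDerivAt_cos ψ))).deriv
  unfold polarCurvNum
  rw [hc, hs, hcc, hss]
  simp only [Pi.neg_apply]
  linear_combination (f ψ ^ 2 + 2 * f' ψ ^ 2 - f ψ * f'' ψ) * Real.sin_sq_add_cos_sq ψ

lemma polarCurvNum_exp (m ψ : ℝ) :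
    polarCurvNum (fun t => Real.exp (-m * (1 - Real.cos t))) ψ =
      Real.exp (-m * (1 - Real.cos ψ)) ^ 2 * (1 + m * Real.cos ψ + m ^ 2 * Real.sin ψ ^ 2) := by
  have hf (t : ℝ) : HasDerivAt (fun t => Real.exp (-m * (1 - Real.cos t)))
      (Real.exp (-m * (1 - Real.cos t)) * (-m * Real.sin t)) t := by
    simpa using (((Real.hasDerivAt_cos t).const_sub 1).const_mul (-m)).exp
  have hf' (t : ℝ) := (hf t).mul ((Real.hasDerivAt_sin t).const_mul (-m))
  rw [polarCurvNum_eq hf hf']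
  ring

lemma forall_polarCurvNum_exp_pos_iff {m : ℝ} (hm : 0 ≤ m) :
    (∀ ψ : ℝ, 0 < polarCurvNum (fun t => Real.exp (-m * (1 - Real.cos t))) ψ) ↔ m < 1 := by
  simp only [polarCurvNum_exp]
  constructor
  · intro h
    have hπ := pos_of_mul_pos_right (h Real.pi) (sq_nonneg _)
    simp only [Real.cos_pi, Real.sin_pi] at hπ
    linarith
  · intro h ψ
    have hcos := mul_le_mul_of_nonneg_left (Real.neg_one_le_cos ψ) hm
    have hsin : 0 ≤ m ^ 2 * Real.sin ψ ^ 2 := by positivity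
    exact mul_pos (by positivity) (by linarith)

/-- For the polar velocity profile `γ(ψ) = exp(−m(1−cos ψ))(cos ψ, sin ψ)` with
`m > 0`, the curvature numerator is positive everywhere iff `m < 1`.
Consequently, in the `exp(−β ρ̄²(1−cos ψ))` model the profile has
everywhere-positive curvature numerator exactly when `ρ̄ < 1/√β`, and in the
`exp(−β ρ̄(1−cos ψ))` model exactly when `ρ̄ < 1/β`. -/
theorem velocity_profile_convexity_iff :
    (∀ m : ℝ, 0 < m →
      ((∀ ψ : ℝ, 0 < polarCurvNum (fun t => Real.exp (-m * (1 - Real.cos t))) ψ) ↔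
        m < 1)) ∧
    (∀ β ρ : ℝ, 0 < β → 0 ≤ ρ →
      ((∀ ψ : ℝ, 0 <
          polarCurvNum (fun t => Real.exp (-(β * ρ ^ 2) * (1 - Real.cos t))) ψ) ↔
        ρ < 1 / Real.sqrt β)) ∧
    (∀ β ρ : ℝ, 0 < β → 0 ≤ ρ →
      ((∀ ψ : ℝ, 0 <
          polarCurvNum (fun t => Real.exp (-(β * ρ) * (1 - Real.cos t))) ψ) ↔
        ρ < 1 / β)) := by
  refine ⟨fun m hm => forall_polarCurvNum_exp_pos_iff hm.le, fun β ρ hβ hρ => ?_,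
    fun β ρ hβ hρ => ?_⟩
  · rw [forall_polarCurvNum_exp_pos_iff (by positivity), lt_div_iff₀ (Real.sqrt_pos.2 hβ),
      ← sq_lt_one_iff₀ (by positivity : 0 ≤ ρ * Real.sqrt β), mul_pow,
      Real.sq_sqrt hβ.le, mul_comm]
  · rw [forall_polarCurvNum_exp_pos_iff (by positivity), lt_div_iff₀ hβ, mul_comm]
end

section
/- Let f : ℝ → ℝ be twice differentiable, let a, b, Δ ∈ ℝ and set ψ = a − b + Δ. Suppose cos a ≠ 0, f(ψ) > 0, and the first-order optimality condition sin(a)·f(ψ) = cos(a)·f'(ψ) holds. Define g_a = −cos(a) f(ψ) − 2 sin(a) f'(ψ) + cos(a) f''(ψ) and g_b = −sin(a) f'(ψ) + cos(a) f''(ψ). If f(ψ) f''(ψ) − f(ψ)² − 2 f'(ψ)² ≠ 0, then g_a ≠ 0 and g_b / g_a = (f(ψ) f''(ψ) − f'(ψ)²) / (f(ψ) f''(ψ) − f(ψ)² − 2 f'(ψ)²). -/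
/-- Implicit differentiation of the first-order optimality condition for the
best reply map: under the optimality condition `sin(a) f(ψ) = cos(a) f'(ψ)`
(with `ψ = a − b + Δ`), the ratio of the partial derivatives `g_b / g_a`
simplifies to `(f f'' − f'²)/(f f'' − f² − 2 f'²)`. -/
theorem best_reply_derivative (f : ℝ → ℝ)
    (hf : Differentiable ℝ f) (hf' : Differentiable ℝ (deriv f))
    (a b Δ : ℝ) (ψ : ℝ) (hψ : ψ = a - b + Δ)
    (hcos : Real.cos a ≠ 0) (hfpos : 0 < f ψ)
    (hopt : Real.sin a * f ψ = Real.cos a * deriv f ψ)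
    (hden : f ψ * deriv (deriv f) ψ - f ψ ^ 2 - 2 * (deriv f ψ) ^ 2 ≠ 0) :
    (-Real.cos a * f ψ - 2 * Real.sin a * deriv f ψ +
        Real.cos a * deriv (deriv f) ψ) ≠ 0 ∧
    (-Real.sin a * deriv f ψ + Real.cos a * deriv (deriv f) ψ) /
        (-Real.cos a * f ψ - 2 * Real.sin a * deriv f ψ +
          Real.cos a * deriv (deriv f) ψ)
      = (f ψ * deriv (deriv f) ψ - (deriv f ψ) ^ 2) /
          (f ψ * deriv (deriv f) ψ - f ψ ^ 2 - 2 * (deriv f ψ) ^ 2) := by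
  set A := -Real.cos a * f ψ - 2 * Real.sin a * deriv f ψ +
    Real.cos a * deriv (deriv f) ψ
  set D := f ψ * deriv (deriv f) ψ - f ψ ^ 2 - 2 * (deriv f ψ) ^ 2
  have hfA : f ψ * A = Real.cos a * D := by
    linear_combination (-2 * deriv f ψ) * hopt
  have hfB : f ψ * (-Real.sin a * deriv f ψ + Real.cos a * deriv (deriv f) ψ) =
      Real.cos a * (f ψ * deriv (deriv f) ψ - (deriv f ψ) ^ 2) := by
    linear_combination (-deriv f ψ) * hopt
  have hA0 : A ≠ 0 := right_ne_zero_of_mul (hfA ▸ mul_ne_zero hcos hden)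
  refine ⟨hA0, ?_⟩
  rw [← mul_div_mul_left _ A hfpos.ne', hfA, hfB, mul_div_mul_left _ _ hcos]
end

section
/- Let F, R > 0, α ∈ (0, 2π), θ ∈ ℝ, and ρ₀, ρₓ ∈ ℝ. Then the vector-valued iterated integral ∫_{θ−α/2}^{θ+α/2} ∫_0^R (−F)·(cos γ, sin γ)·(ρ₀ + ρₓ·r·cos γ) dr dγ equals (−F ρₓ R² α/4, 0) − 2 F ρ₀ R sin(α/2)·(cos θ, sin θ) − (F ρₓ R² sin(α)/4)·(cos 2θ, sin 2θ). Consequently, the total velocity v(θ) = (cos θ, sin θ) + w_i(θ), where w_i(θ) is this integral, equals (−F ρₓ R² α/4, 0) + (1 − 2 F ρ₀ R sin(α/2))·(cos θ, sin θ) − (F ρₓ R² sin(α)/4)·(cos 2θ, sin 2θ). -/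
open intervalIntegral

theorem integral_radial_linear_density (F R ρ₀ ρₓ γ : ℝ) :
    (∫ r in (0 : ℝ)..R,
        (-F * (ρ₀ + ρₓ * r * Real.cos γ)) • ((Real.cos γ, Real.sin γ) : ℝ × ℝ))
      = (-F * (ρ₀ * R + ρₓ * R ^ 2 / 2 * Real.cos γ)) •
          ((Real.cos γ, Real.sin γ) : ℝ × ℝ) := by
  rw [intervalIntegral.integral_smul_const]
  congr 1
  have h : ∀ r ∈ Set.uIcc 0 R, HasDerivAt
      (fun r : ℝ => -F * (ρ₀ * r + ρₓ * r ^ 2 / 2 * Real.cos γ))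
      (-F * (ρ₀ + ρₓ * r * Real.cos γ)) r := fun r _ => by
    refine HasDerivAt.congr_deriv ((((hasDerivAt_id r).const_mul ρ₀).add
      (((((hasDerivAt_id r).pow 2).const_mul ρₓ).div_const 2).mul_const
        (Real.cos γ))).const_mul (-F)) ?_
    simp only [id_eq]
    push_cast
    ring
  rw [integral_eq_sub_of_hasDerivAt h (Continuous.intervalIntegrable (by fun_prop) _ _)]
  ring

theorem integral_angular_affine_cos (A B a b : ℝ) :
    (∫ γ in a..b, (A + B * Real.cos γ) • ((Real.cos γ, Real.sin γ) : ℝ × ℝ))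
      = (A * (Real.sin b - Real.sin a)
            + B / 2 * (b + Real.sin b * Real.cos b - (a + Real.sin a * Real.cos a)),
          A * (Real.cos a - Real.cos b)
            + B / 2 * (Real.sin b ^ 2 - Real.sin a ^ 2)) := by
  have h : ∀ γ ∈ Set.uIcc a b, HasDerivAt
      (fun γ : ℝ => ((A * Real.sin γ + B / 2 * (γ + Real.sin γ * Real.cos γ),
        -A * Real.cos γ + B / 2 * Real.sin γ ^ 2) : ℝ × ℝ))
      ((A + B * Real.cos γ) • ((Real.cos γ, Real.sin γ) : ℝ × ℝ)) γ := fun γ _ => by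
    have hs := Real.hasDerivAt_sin γ
    have hc := Real.hasDerivAt_cos γ
    refine HasDerivAt.congr_deriv (((hs.const_mul A).add
      (((hasDerivAt_id γ).add (hs.mul hc)).const_mul (B / 2))).prodMk
      ((hc.const_mul (-A)).add ((hs.pow 2).const_mul (B / 2)))) ?_
    ext
    · simp
      linear_combination (-B / 2) * Real.sin_sq_add_cos_sq γ
    · simp
      ring
  rw [integral_eq_sub_of_hasDerivAt h (Continuous.intervalIntegrable (by fun_prop) _ _)]
  ext <;> simp <;> ring

theorem integral_sector_linear_density (F R α θ ρ₀ ρₓ : ℝ) :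
    (∫ γ in (θ - α / 2)..(θ + α / 2), ∫ r in (0 : ℝ)..R,
        (-F * (ρ₀ + ρₓ * r * Real.cos γ)) • ((Real.cos γ, Real.sin γ) : ℝ × ℝ))
      = ((-F * ρₓ * R ^ 2 * α / 4, 0) : ℝ × ℝ) -
          (2 * F * ρ₀ * R * Real.sin (α / 2)) •
            ((Real.cos θ, Real.sin θ) : ℝ × ℝ) -
          (F * ρₓ * R ^ 2 * Real.sin α / 4) •
            ((Real.cos (2 * θ), Real.sin (2 * θ)) : ℝ × ℝ) := by
  have hα : Real.sin α = 2 * Real.sin (α / 2) * Real.cos (α / 2) := by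
    rw [← Real.sin_two_mul]
    ring_nf
  simp_rw [integral_radial_linear_density, mul_add, ← mul_assoc]
  rw [integral_angular_affine_cos, hα, Real.sin_two_mul, Real.cos_two_mul']
  simp only [Real.sin_add, Real.sin_sub, Real.cos_add, Real.cos_sub]
  ext
  · simp
    ring
  · simp
    ring

/-- Evaluation of the interaction velocity integral for the non-local
intra-crowd model with a linear density `ρ(x,y) = ρ₀ + ρₓ x`, over a circular
sensing sector of radius `R` and angle `α` oriented along `θ`, and the
resulting formula for the total velocity `v(θ) = (cos θ, sin θ) + w_i(θ)`. -/
theorem interaction_velocity_linear_density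
    (F R α θ ρ₀ ρₓ : ℝ) (hF : 0 < F) (hR : 0 < R)
    (hα : α ∈ Set.Ioo (0 : ℝ) (2 * Real.pi)) :
    (∫ γ in (θ - α / 2)..(θ + α / 2), ∫ r in (0 : ℝ)..R,
        (-F * (ρ₀ + ρₓ * r * Real.cos γ)) • ((Real.cos γ, Real.sin γ) : ℝ × ℝ))
      = ((-F * ρₓ * R ^ 2 * α / 4, 0) : ℝ × ℝ) -
          (2 * F * ρ₀ * R * Real.sin (α / 2)) •
            ((Real.cos θ, Real.sin θ) : ℝ × ℝ) -
          (F * ρₓ * R ^ 2 * Real.sin α / 4) •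
            ((Real.cos (2 * θ), Real.sin (2 * θ)) : ℝ × ℝ) ∧
    ((Real.cos θ, Real.sin θ) : ℝ × ℝ) +
        (∫ γ in (θ - α / 2)..(θ + α / 2), ∫ r in (0 : ℝ)..R,
          (-F * (ρ₀ + ρₓ * r * Real.cos γ)) • ((Real.cos γ, Real.sin γ) : ℝ × ℝ))
      = ((-F * ρₓ * R ^ 2 * α / 4, 0) : ℝ × ℝ) +
          (1 - 2 * F * ρ₀ * R * Real.sin (α / 2)) •
            ((Real.cos θ, Real.sin θ) : ℝ × ℝ) -
          (F * ρₓ * R ^ 2 * Real.sin α / 4) •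
            ((Real.cos (2 * θ), Real.sin (2 * θ)) : ℝ × ℝ) := by
  have h := integral_sector_linear_density F R α θ ρ₀ ρₓ
  refine ⟨h, ?_⟩
  rw [h, sub_smul, one_smul]
  abel
end

section
/- Let C₁, C₂, C₃ ∈ ℝ and define v(θ) = (v₁(θ), v₂(θ)) = (−C₃/4, 0) + C₁·(cos θ, sin θ) − (C₂/4)·(cos 2θ, sin 2θ). Then for every θ ∈ ℝ, v₁'(θ) v₂''(θ) − v₂'(θ) v₁''(θ) = C₁² + C₂²/2 − (3/2)·C₁ C₂·cos θ. Moreover, if C₁ ≥ 0 and C₂ ≥ 0, then the minimum of this expression over θ equals C₁² + C₂²/2 − (3/2) C₁ C₂ = (C₁ − C₂)(2C₁ − C₂)/2, so that (v₁'v₂'' − v₂'v₁'' > 0 for all θ) holds if and only if (C₁ − C₂)(2C₁ − C₂) > 0. -/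
theorem deriv_const_add_cos_sub_cos_two_mul (a b c : ℝ) :
    deriv (fun t => a + b * Real.cos t - c * Real.cos (2 * t)) =
      fun t => 2 * c * Real.sin (2 * t) - b * Real.sin t := by
  funext t
  have h := (((Real.hasDerivAt_cos t).const_mul b).const_add a).sub
    ((((hasDerivAt_id t).const_mul 2).cos).const_mul c)
  refine (h.congr_deriv ?_).deriv
  simp only [id]
  ring

theorem deriv_sin_sub_sin_two_mul (b c : ℝ) :
    deriv (fun t => b * Real.sin t - c * Real.sin (2 * t)) =
      fun t => b * Real.cos t - 2 * c * Real.cos (2 * t) := by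
  funext t
  have h := ((Real.hasDerivAt_sin t).const_mul b).sub
    ((((hasDerivAt_id t).const_mul 2).sin).const_mul c)
  refine (h.congr_deriv ?_).deriv
  simp only [id]
  ring

theorem deriv_sin_two_mul_sub_sin (b c : ℝ) :
    deriv (fun t => c * Real.sin (2 * t) - b * Real.sin t) =
      fun t => 2 * c * Real.cos (2 * t) - b * Real.cos t := by
  funext t
  have h := ((((hasDerivAt_id t).const_mul 2).sin).const_mul c).sub
    ((Real.hasDerivAt_sin t).const_mul b)
  refine (h.congr_deriv ?_).deriv
  simp only [id]
  ring

theorem deriv_cos_sub_cos_two_mul (b c : ℝ) :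
    deriv (fun t => b * Real.cos t - c * Real.cos (2 * t)) =
      fun t => 2 * c * Real.sin (2 * t) - b * Real.sin t := by
  simpa only [zero_add] using deriv_const_add_cos_sub_cos_two_mul 0 b c

/-- The curvature numerator of the intra-crowd velocity profile
`v(θ) = (−C₃/4, 0) + C₁ (cos θ, sin θ) − (C₂/4)(cos 2θ, sin 2θ)` equals
`C₁² + C₂²/2 − (3/2) C₁ C₂ cos θ`; if `C₁, C₂ ≥ 0` its minimum over `θ` is
`C₁² + C₂²/2 − (3/2) C₁ C₂ = (C₁ − C₂)(2C₁ − C₂)/2`, so it is everywhere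
positive iff `(C₁ − C₂)(2C₁ − C₂) > 0`. -/
theorem intra_crowd_curvature_numerator (C₁ C₂ C₃ : ℝ) :
    (∀ θ : ℝ,
      deriv (fun t => -C₃ / 4 + C₁ * Real.cos t - C₂ / 4 * Real.cos (2 * t)) θ *
          deriv (deriv (fun t => C₁ * Real.sin t - C₂ / 4 * Real.sin (2 * t))) θ -
        deriv (fun t => C₁ * Real.sin t - C₂ / 4 * Real.sin (2 * t)) θ *
          deriv (deriv
            (fun t => -C₃ / 4 + C₁ * Real.cos t - C₂ / 4 * Real.cos (2 * t))) θ
        = C₁ ^ 2 + C₂ ^ 2 / 2 - 3 / 2 * C₁ * C₂ * Real.cos θ) ∧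
    (0 ≤ C₁ → 0 ≤ C₂ →
      (IsLeast
        (Set.range fun θ : ℝ => C₁ ^ 2 + C₂ ^ 2 / 2 - 3 / 2 * C₁ * C₂ * Real.cos θ)
        (C₁ ^ 2 + C₂ ^ 2 / 2 - 3 / 2 * C₁ * C₂)) ∧
      (C₁ ^ 2 + C₂ ^ 2 / 2 - 3 / 2 * C₁ * C₂ = (C₁ - C₂) * (2 * C₁ - C₂) / 2) ∧
      ((∀ θ : ℝ, 0 <
          deriv (fun t => -C₃ / 4 + C₁ * Real.cos t - C₂ / 4 * Real.cos (2 * t)) θ *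
              deriv (deriv
                (fun t => C₁ * Real.sin t - C₂ / 4 * Real.sin (2 * t))) θ -
            deriv (fun t => C₁ * Real.sin t - C₂ / 4 * Real.sin (2 * t)) θ *
              deriv (deriv
                (fun t => -C₃ / 4 + C₁ * Real.cos t - C₂ / 4 * Real.cos (2 * t))) θ) ↔
        0 < (C₁ - C₂) * (2 * C₁ - C₂))) := by
  have key : ∀ θ : ℝ,
      deriv (fun t => -C₃ / 4 + C₁ * Real.cos t - C₂ / 4 * Real.cos (2 * t)) θ *
          deriv (deriv (fun t => C₁ * Real.sin t - C₂ / 4 * Real.sin (2 * t))) θ -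
        deriv (fun t => C₁ * Real.sin t - C₂ / 4 * Real.sin (2 * t)) θ *
          deriv (deriv
            (fun t => -C₃ / 4 + C₁ * Real.cos t - C₂ / 4 * Real.cos (2 * t))) θ
        = C₁ ^ 2 + C₂ ^ 2 / 2 - 3 / 2 * C₁ * C₂ * Real.cos θ := by
    intro θ
    simp only [deriv_const_add_cos_sub_cos_two_mul, deriv_sin_sub_sin_two_mul,
      deriv_sin_two_mul_sub_sin, deriv_cos_sub_cos_two_mul]
    have h : Real.cos θ = Real.cos (2 * θ) * Real.cos θ + Real.sin (2 * θ) * Real.sin θ := by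
      rw [← Real.cos_sub]
      ring_nf
    linear_combination C₁ ^ 2 * Real.sin_sq_add_cos_sq θ +
      C₂ ^ 2 / 2 * Real.sin_sq_add_cos_sq (2 * θ) + 3 / 2 * C₁ * C₂ * h
  refine ⟨key, fun h₁ h₂ => ?_⟩
  have hle : ∀ θ : ℝ, C₁ ^ 2 + C₂ ^ 2 / 2 - 3 / 2 * C₁ * C₂ ≤
      C₁ ^ 2 + C₂ ^ 2 / 2 - 3 / 2 * C₁ * C₂ * Real.cos θ := fun θ => by
    nlinarith [mul_le_mul_of_nonneg_left (Real.cos_le_one θ) (mul_nonneg h₁ h₂)]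
  refine ⟨⟨⟨0, by simp⟩, Set.forall_mem_range.2 hle⟩, by ring, ?_⟩
  simp only [key]
  constructor
  · intro h
    have h₀ := h 0
    rw [Real.cos_zero] at h₀
    linarith
  · intro h θ
    linarith [hle θ]
end
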